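/- arXiv:1107.2817 — 9 statements merged into one kernel-verified Lean document; each statement's English description precedes it below -/
import Mathlib

section
/- Let ρ ⊆ X × Y be a relation whose domain is ε-dense in (X,d) and whose image is μ-dense in (Y,D), and let ρ̄ be its cartographic generalization. Then res(ρ̄) ≤ acc(ρ) + 2(ε + μ). -/
open Metric ENNReal

variable {X Y : Type*} [MetricSpace X] [MetricSpace Y]

/-- The accuracy of a relation `ρ ⊆ X × Y`:
`acc(ρ) = sup{ |D(y₁,y₂) − d(x₁,x₂)| : (x₁,y₁) ∈ ρ, (x₂,y₂) ∈ ρ }`, in `[0,∞]`. -/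
noncomputable def accRel (ρ : Set (X × Y)) : ℝ≥0∞ :=
  ⨆ (p : X × Y) (_ : p ∈ ρ) (q : X × Y) (_ : q ∈ ρ),
    ENNReal.ofReal |dist p.2 q.2 - dist p.1 q.1|

/-- The resolution of a relation `ρ ⊆ X × Y`:
`res(ρ) = sup{ d(x₁,x₂) : ∃ y, (x₁,y) ∈ ρ and (x₂,y) ∈ ρ }`, in `[0,∞]`. -/
noncomputable def resRel (ρ : Set (X × Y)) : ℝ≥0∞ :=
  ⨆ (x₁ : X) (x₂ : X) (z : Y) (_ : (x₁, z) ∈ ρ ∧ (x₂, z) ∈ ρ),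
    ENNReal.ofReal (dist x₁ x₂)

/-- The precision of a relation `ρ ⊆ X × Y`:
`prec(ρ) = sup{ D(y₁,y₂) : ∃ x, (x,y₁) ∈ ρ and (x,y₂) ∈ ρ }`, in `[0,∞]`. -/
noncomputable def precRel (ρ : Set (X × Y)) : ℝ≥0∞ :=
  ⨆ (y₁ : Y) (y₂ : Y) (x : X) (_ : (x, y₁) ∈ ρ ∧ (x, y₂) ∈ ρ),
    ENNReal.ofReal (dist y₁ y₂)

/-- A subset `M ⊆ X` is `ε`-dense if every point of `X` is within distance `ε` of `M`. -/
def IsEpsDense (M : Set X) (ε : ℝ) : Prop :=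
  ∀ u : X, ∃ m ∈ M, dist m u ≤ ε

/-- The cartographic generalization `ρ̄` of a relation `ρ ⊆ X × Y`:
`(x,y) ∈ ρ̄` iff there is `(x',y') ∈ ρ` with `d(x,x') ≤ ε` and `D(y,y') ≤ μ`. -/
def cartGen (ρ : Set (X × Y)) (ε μ : ℝ) : Set (X × Y) :=
  {p | ∃ q ∈ ρ, dist p.1 q.1 ≤ ε ∧ dist p.2 q.2 ≤ μ}

/-- if `dom ρ` is `ε`-dense in `X` and `im ρ` is `μ`-dense in `Y`, then the
resolution of the cartographic generalization satisfies `res(ρ̄) ≤ acc(ρ) + 2(ε + μ)`. -/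
theorem resRel_cartGen_le (ρ : Set (X × Y)) (ε μ : ℝ) (hε : 0 < ε) (hμ : 0 < μ)
    (hdom : IsEpsDense (Prod.fst '' ρ) ε) (him : IsEpsDense (Prod.snd '' ρ) μ) :
    resRel (cartGen ρ ε μ) ≤ accRel ρ + ENNReal.ofReal (2 * (ε + μ)) := by
  refine iSup_le fun x₁ => iSup_le fun x₂ => iSup_le fun z => iSup_le ?_
  rintro ⟨⟨p, hp, hpx, hpz⟩, ⟨q, hq, hqx, hqz⟩⟩
  have hacc : ENNReal.ofReal |dist p.2 q.2 - dist p.1 q.1| ≤ accRel ρ :=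
    le_iSup₂_of_le p hp (le_iSup₂_of_le q hq le_rfl)
  have hX : dist x₁ x₂ ≤ ε + dist p.1 q.1 + ε := by
    have h := dist_triangle4 x₁ p.1 q.1 x₂
    rw [dist_comm q.1 x₂] at h
    linarith
  have hY : dist p.2 q.2 ≤ μ + μ := by
    have h := dist_triangle_left p.2 q.2 z
    linarith
  have hdist : dist x₁ x₂ ≤ |dist p.2 q.2 - dist p.1 q.1| + 2 * (ε + μ) := by
    linarith [neg_abs_le (dist p.2 q.2 - dist p.1 q.1)]
  calc
    ENNReal.ofReal (dist x₁ x₂)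
        ≤ ENNReal.ofReal (|dist p.2 q.2 - dist p.1 q.1| + 2 * (ε + μ)) :=
      ENNReal.ofReal_le_ofReal hdist
    _ ≤ ENNReal.ofReal |dist p.2 q.2 - dist p.1 q.1| + ENNReal.ofReal (2 * (ε + μ)) :=
      ENNReal.ofReal_add_le
    _ ≤ accRel ρ + ENNReal.ofReal (2 * (ε + μ)) := by gcongr
end

section
/- Let ρ ⊆ X × Y be a relation whose domain is ε-dense in (X,d) and whose image is μ-dense in (Y,D), and let ρ̄ be its cartographic generalization. Then prec(ρ̄) ≤ acc(ρ) + 2(ε + μ). -/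
open Metric ENNReal

variable {X Y : Type*} [MetricSpace X] [MetricSpace Y]

/-- if `dom ρ` is `ε`-dense in `X` and `im ρ` is `μ`-dense in `Y`, then the
precision of the cartographic generalization satisfies `prec(ρ̄) ≤ acc(ρ) + 2(ε + μ)`. -/
theorem precRel_cartGen_le (ρ : Set (X × Y)) (ε μ : ℝ) (hε : 0 < ε) (hμ : 0 < μ)
    (hdom : IsEpsDense (Prod.fst '' ρ) ε) (him : IsEpsDense (Prod.snd '' ρ) μ) :
    precRel (cartGen ρ ε μ) ≤ accRel ρ + ENNReal.ofReal (2 * (ε + μ)) := by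
  refine iSup_le fun y₁ => iSup_le fun y₂ => iSup_le fun x => iSup_le ?_
  rintro ⟨⟨⟨a₁, b₁⟩, h₁, hx₁, hy₁⟩, ⟨⟨a₂, b₂⟩, h₂, hx₂, hy₂⟩⟩
  dsimp only at hx₁ hy₁ hx₂ hy₂
  have hacc : ENNReal.ofReal |dist b₁ b₂ - dist a₁ a₂| ≤ accRel ρ :=
    le_iSup₂_of_le (a₁, b₁) h₁ (le_iSup₂_of_le (a₂, b₂) h₂ le_rfl)
  have hY : dist y₁ y₂ ≤ dist y₁ b₁ + dist b₁ b₂ + dist b₂ y₂ := dist_triangle4 _ _ _ _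
  have hX : dist a₁ a₂ ≤ dist x a₁ + dist x a₂ := dist_triangle_left _ _ _
  have habs := le_abs_self (dist b₁ b₂ - dist a₁ a₂)
  rw [dist_comm b₂ y₂] at hY
  calc ENNReal.ofReal (dist y₁ y₂)
      ≤ ENNReal.ofReal (|dist b₁ b₂ - dist a₁ a₂| + 2 * (ε + μ)) :=
        ENNReal.ofReal_le_ofReal (by linarith)
    _ = ENNReal.ofReal |dist b₁ b₂ - dist a₁ a₂| + ENNReal.ofReal (2 * (ε + μ)) :=
        ENNReal.ofReal_add (abs_nonneg _) (by positivity)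
    _ ≤ accRel ρ + ENNReal.ofReal (2 * (ε + μ)) := by gcongr
end

section
/- Let ρ ⊆ X × Y be a relation whose domain is ε-dense in (X,d) and whose image is μ-dense in (Y,D), and let ρ̄ be its cartographic generalization. Then |acc(ρ̄) − acc(ρ)| ≤ 2(ε + μ). -/
open Metric ENNReal

variable {X Y : Type*} [MetricSpace X] [MetricSpace Y]

theorem le_accRel {ρ : Set (X × Y)} {p q : X × Y} (hp : p ∈ ρ) (hq : q ∈ ρ) :
    ENNReal.ofReal |dist p.2 q.2 - dist p.1 q.1| ≤ accRel ρ :=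
  le_iSup₂_of_le p hp <| le_iSup₂_of_le q hq le_rfl

theorem accRel_mono {ρ σ : Set (X × Y)} (h : ρ ⊆ σ) : accRel ρ ≤ accRel σ :=
  iSup₂_le fun _ hp => iSup₂_le fun _ hq => le_accRel (h hp) (h hq)

theorem subset_cartGen (ρ : Set (X × Y)) {ε μ : ℝ} (hε : 0 ≤ ε) (hμ : 0 ≤ μ) :
    ρ ⊆ cartGen ρ ε μ :=
  fun p hp => ⟨p, hp, by simpa using hε, by simpa using hμ⟩

theorem accRel_cartGen_le (ρ : Set (X × Y)) (ε μ : ℝ) :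
    accRel (cartGen ρ ε μ) ≤ accRel ρ + ENNReal.ofReal (2 * (ε + μ)) := by
  refine iSup₂_le fun p ⟨p', hp', hp₁, hp₂⟩ => iSup₂_le fun q ⟨q', hq', hq₁, hq₂⟩ => ?_
  have h : |dist p.2 q.2 - dist p.1 q.1| ≤
      |dist p'.2 q'.2 - dist p'.1 q'.1| + 2 * (ε + μ) := by
    have h₁ := abs_le.1 (dist_dist_dist_le p.1 q.1 p'.1 q'.1)
    have h₂ := abs_le.1 (dist_dist_dist_le p.2 q.2 p'.2 q'.2)
    have h₃ := abs_le.1 (le_refl |dist p'.2 q'.2 - dist p'.1 q'.1|)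
    rw [abs_le]
    constructor <;> linarith
  calc
    _ ≤ _ := ENNReal.ofReal_le_ofReal h
    _ ≤ _ := ENNReal.ofReal_add_le
    _ ≤ _ := by gcongr; exact le_accRel hp' hq'

/-- if `dom ρ` is `ε`-dense in `X` and `im ρ` is `μ`-dense in `Y`, then
`|acc(ρ̄) − acc(ρ)| ≤ 2(ε + μ)`, stated in `[0,∞]` as the pair of inequalities
`acc(ρ̄) ≤ acc(ρ) + 2(ε+μ)` and `acc(ρ) ≤ acc(ρ̄) + 2(ε+μ)`. -/
theorem abs_accRel_cartGen_sub_accRel_le (ρ : Set (X × Y)) (ε μ : ℝ) (hε : 0 < ε) (hμ : 0 < μ)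
    (hdom : IsEpsDense (Prod.fst '' ρ) ε) (him : IsEpsDense (Prod.snd '' ρ) μ) :
    accRel (cartGen ρ ε μ) ≤ accRel ρ + ENNReal.ofReal (2 * (ε + μ)) ∧
      accRel ρ ≤ accRel (cartGen ρ ε μ) + ENNReal.ofReal (2 * (ε + μ)) :=
  ⟨accRel_cartGen_le ρ ε μ,
    (accRel_mono (subset_cartGen ρ hε.le hμ.le)).trans le_self_add⟩
end

section
/- (Cascading of errors.) Let ρ^x_ε be a zoom sequence at x ∈ X with zoom modulus F, let μ ∈ (0,1), ε ∈ (0,1), and let ρ^x_{ε,μ} be the relation comparing the maps at scales ε and εμ. Then the accuracy of ρ^x_{ε,μ}, measured with the distance (1/μ)·D on the domain and D on the image, satisfies: sup{ |D(u″,v″) − (1/μ)·D(u′,v′)| : (u′,u″) ∈ ρ^x_{ε,μ}, (v′,v″) ∈ ρ^x_{ε,μ} } ≤ (1/μ)·F(ε) + F(εμ). -/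
open Metric ENNReal

variable {X Y : Type*} [MetricSpace X] [MetricSpace Y]

/-- A zoom sequence at `x ∈ X` with base point `y ∈ Y` and zoom modulus `F`.
Here the metric space `Y` plays the role of the closed unit ball `B̄(y,1)`
(axiom `ballY`), the relations `ρ ε ⊆ B̄(x,ε) × Y` for `ε ∈ (0,1]` have full domain
`B̄(x,ε)` and full image `Y`, contain the pair `(x,y)`, and for every `ε ∈ (0,1)` the
accuracy at scale `ε` is bounded by `F ε`:
`sup{ |D(y₁,y₂) − (1/ε)·d(x₁,x₂)| : (x₁,y₁), (x₂,y₂) ∈ ρ ε } ≤ F ε`. -/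
structure IsZoomSeq (x : X) (y : Y) (ρ : ℝ → Set (X × Y)) (F : ℝ → ℝ) : Prop where
  ballY : ∀ z : Y, dist z y ≤ 1
  F_nonneg : ∀ ε ∈ Set.Ioo (0:ℝ) 1, 0 ≤ F ε
  F_lim : Filter.Tendsto F (nhdsWithin 0 (Set.Ioo 0 1)) (nhds 0)
  mem_ball : ∀ ε ∈ Set.Ioc (0:ℝ) 1, ∀ p ∈ ρ ε, p.1 ∈ closedBall x ε
  dom_full : ∀ ε ∈ Set.Ioc (0:ℝ) 1, ∀ u ∈ closedBall x ε, ∃ v : Y, (u, v) ∈ ρ ε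
  im_full : ∀ ε ∈ Set.Ioc (0:ℝ) 1, ∀ v : Y, ∃ u : X, (u, v) ∈ ρ ε
  base_mem : ∀ ε ∈ Set.Ioc (0:ℝ) 1, (x, y) ∈ ρ ε
  acc_le : ∀ ε ∈ Set.Ioo (0:ℝ) 1, ∀ p ∈ ρ ε, ∀ q ∈ ρ ε,
    |dist p.2 q.2 - (1/ε) * dist p.1 q.1| ≤ F ε

/-- The comparison relation `ρ^x_{ε,μ} ⊆ B̄(y,μ) × B̄(y,1)` between the maps at scales
`ε` and `εμ`: `(u',u'') ∈ ρ^x_{ε,μ}` iff there is `u ∈ B̄(x,εμ)` with `(u,u') ∈ ρ ε`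
and `(u,u'') ∈ ρ (εμ)`. -/
def scaleComp (ρ : ℝ → Set (X × Y)) (x : X) (ε μ : ℝ) : Set (Y × Y) :=
  {p | ∃ u ∈ closedBall x (ε * μ), (u, p.1) ∈ ρ ε ∧ (u, p.2) ∈ ρ (ε * μ)}

/-- The distance `D_μ((u',u''),(v',v'')) = (1/μ)·D(u',v') + D(u'',v'')` on `Y × Y`. -/
noncomputable def Dmu (μ : ℝ) (p q : Y × Y) : ℝ := (1/μ) * dist p.1 q.1 + dist p.2 q.2

/-- The Hausdorff distance between `A, B ⊆ Y × Y`, computed with respect to the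
distance `D_μ`, is at most `c`. -/
def hausLe (μ : ℝ) (A B : Set (Y × Y)) (c : ℝ) : Prop :=
  (∀ a ∈ A, ∃ b ∈ B, Dmu μ a b ≤ c) ∧ (∀ b ∈ B, ∃ a ∈ A, Dmu μ a b ≤ c)

/-- The zoom sequence `ρ` is scale stable at scale `μ`, with limit relation
`ρbar ⊆ B̄(y,μ) × B̄(y,1)` (nonempty) and scale stability modulus `Fμ`: for every
`ε ∈ (0,1)` the Hausdorff distance (w.r.t. `D_μ`) between `ρ^x_{ε,μ}` and `ρbar`
is at most `Fμ ε`. -/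
structure IsScaleStable (ρ : ℝ → Set (X × Y)) (x : X) (y : Y) (μ : ℝ)
    (ρbar : Set (Y × Y)) (Fμ : ℝ → ℝ) : Prop where
  nonempty : ρbar.Nonempty
  subset_balls : ρbar ⊆ closedBall y μ ×ˢ closedBall y 1
  Fμ_nonneg : ∀ ε ∈ Set.Ioo (0:ℝ) 1, 0 ≤ Fμ ε
  Fμ_lim : Filter.Tendsto Fμ (nhdsWithin 0 (Set.Ioo 0 1)) (nhds 0)
  haus_le : ∀ ε ∈ Set.Ioo (0:ℝ) 1, hausLe μ (scaleComp ρ x ε μ) ρbar (Fμ ε)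

/-- cascading of errors: for a zoom sequence `ρ^x_ε` with zoom modulus `F`,
`μ, ε ∈ (0,1)`, and any `(u',u''), (v',v'') ∈ ρ^x_{ε,μ}`, the accuracy of `ρ^x_{ε,μ}`
(measured with distance `(1/μ)·D` on the domain and `D` on the image) satisfies
`|D(u'',v'') − (1/μ)·D(u',v')| ≤ (1/μ)·F ε + F (εμ)`. -/
theorem cascading_of_errors {x : X} {y : Y} {ρ : ℝ → Set (X × Y)} {F : ℝ → ℝ}
    (hz : IsZoomSeq x y ρ F) {μ ε : ℝ} (hμ : μ ∈ Set.Ioo (0:ℝ) 1)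
    (hε : ε ∈ Set.Ioo (0:ℝ) 1) {u' u'' v' v'' : Y}
    (hu : (u', u'') ∈ scaleComp ρ x ε μ) (hv : (v', v'') ∈ scaleComp ρ x ε μ) :
    |dist u'' v'' - (1/μ) * dist u' v'| ≤ (1/μ) * F ε + F (ε * μ) := by
  obtain ⟨u, -, hu₁, hu₂⟩ := hu
  obtain ⟨v, -, hv₁, hv₂⟩ := hv
  have hμ0 : 0 < μ := hμ.1
  have hεμ : ε * μ ∈ Set.Ioo (0:ℝ) 1 :=
    ⟨mul_pos hε.1 hμ0, mul_lt_one_of_nonneg_of_lt_one_left hε.1.le hε.2 hμ.2.le⟩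
  have coarse : |dist u' v' - (1/ε) * dist u v| ≤ F ε := hz.acc_le ε hε _ hu₁ _ hv₁
  have fine : |dist u'' v'' - (1/(ε * μ)) * dist u v| ≤ F (ε * μ) :=
    hz.acc_le _ hεμ _ hu₂ _ hv₂
  calc |dist u'' v'' - (1/μ) * dist u' v'|
      = |(dist u'' v'' - (1/(ε * μ)) * dist u v)
          - (1/μ) * (dist u' v' - (1/ε) * dist u v)| := by
        congr 1
        ring
    _ ≤ |dist u'' v'' - (1/(ε * μ)) * dist u v|
          + |(1/μ) * (dist u' v' - (1/ε) * dist u v)| := abs_sub _ _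
    _ = |dist u'' v'' - (1/(ε * μ)) * dist u v|
          + (1/μ) * |dist u' v' - (1/ε) * dist u v| := by
        rw [abs_mul, abs_of_pos (one_div_pos.2 hμ0)]
    _ ≤ F (ε * μ) + (1/μ) * F ε := by gcongr
    _ = (1/μ) * F ε + F (ε * μ) := add_comm _ _
end

section
/- Let ρ^x_ε be a zoom sequence at x ∈ X with zoom modulus F which is scale stable at scale μ ∈ (0,1) with scale stability modulus F_μ and limit relation ρ̄^x_μ. Then for any (u′,u″), (v′,v″) ∈ ρ̄^x_μ and any ε ∈ (0,1): |D(u″,v″) − (1/μ)·D(u′,v′)| ≤ 2·F_μ(ε) + (1/μ)·F(ε) + F(εμ). -/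
open Metric ENNReal

variable {X Y : Type*} [MetricSpace X] [MetricSpace Y]

/-- for a zoom sequence `ρ^x_ε` with zoom modulus `F`, scale stable at scale
`μ ∈ (0,1)` with modulus `Fμ` and limit relation `ρbar`, any two pairs
`(u',u''), (v',v'') ∈ ρbar` and any `ε ∈ (0,1)` satisfy
`|D(u'',v'') − (1/μ)·D(u',v')| ≤ 2·Fμ ε + (1/μ)·F ε + F (εμ)`. -/
theorem scale_stable_acc_bound {x : X} {y : Y} {ρ : ℝ → Set (X × Y)} {F Fμ : ℝ → ℝ}
    {μ : ℝ} (hμ : μ ∈ Set.Ioo (0:ℝ) 1) {ρbar : Set (Y × Y)}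
    (hz : IsZoomSeq x y ρ F) (hs : IsScaleStable ρ x y μ ρbar Fμ)
    {u' u'' v' v'' : Y} (hu : (u', u'') ∈ ρbar) (hv : (v', v'') ∈ ρbar)
    {ε : ℝ} (hε : ε ∈ Set.Ioo (0:ℝ) 1) :
    |dist u'' v'' - (1/μ) * dist u' v'| ≤ 2 * Fμ ε + (1/μ) * F ε + F (ε * μ) := by
  have hμ0 : 0 < μ := hμ.1
  have hε0 : 0 < ε := hε.1
  have hεμ : ε * μ ∈ Set.Ioo (0:ℝ) 1 :=
    ⟨mul_pos hε0 hμ0, mul_lt_one_of_nonneg_of_lt_one_left hε0.le hε.2 hμ.2.le⟩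
  obtain ⟨⟨a', a''⟩, ⟨a, -, ha', ha''⟩, hau⟩ := (hs.haus_le ε hε).2 _ hu
  obtain ⟨⟨b', b''⟩, ⟨b, -, hb', hb''⟩, hbv⟩ := (hs.haus_le ε hε).2 _ hv
  have h₁ := hz.acc_le ε hε _ ha' _ hb'
  have h₂ := hz.acc_le _ hεμ _ ha'' _ hb''
  simp only [Dmu] at hau hbv h₁ h₂
  have hk : 0 ≤ 1 / μ := by positivity
  have h₁' : |(1/μ) * dist a' b' - 1 / (ε * μ) * dist a b| ≤ (1/μ) * F ε := by
    calc _ = (1/μ) * |dist a' b' - 1 / ε * dist a b| := by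
          rw [← abs_of_nonneg hk, ← abs_mul, abs_of_nonneg hk]
          congr 1
          field_simp
      _ ≤ _ := mul_le_mul_of_nonneg_left h₁ hk
  have h₃ := mul_le_mul_of_nonneg_left (dist_dist_dist_le a' b' u' v') hk
  have h₄ := dist_dist_dist_le a'' b'' u'' v''
  rw [Real.dist_eq] at h₃ h₄
  have h₃' : |(1/μ) * dist a' b' - (1/μ) * dist u' v'| ≤
      (1/μ) * dist a' u' + (1/μ) * dist b' v' := by
    rwa [← mul_sub, abs_mul, abs_of_nonneg hk, ← mul_add]
  rw [abs_le] at *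
  constructor <;> linarith
end

section
/- Let ρ^x_ε be a zoom sequence at x ∈ X with zoom modulus F which is scale stable at scale μ ∈ (0,1) with scale stability modulus F_μ and limit relation ρ̄^x_μ. Then the space (Y,D) is self-similar along ρ̄^x_μ: for any (u′,u″), (v′,v″) ∈ ρ̄^x_μ we have D(u″,v″) = (1/μ)·D(u′,v′). -/
open Metric ENNReal

variable {X Y : Type*} [MetricSpace X] [MetricSpace Y]

/-- Points of the comparison relation satisfy the self-similarity identity up to the accuracies
at the two scales `ε` and `ε * μ`. -/
theorem IsZoomSeq.abs_dist_sub_le_of_mem_scaleComp {x : X} {y : Y} {ρ : ℝ → Set (X × Y)}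
    {F : ℝ → ℝ} (hz : IsZoomSeq x y ρ F) {ε μ : ℝ} (hε : ε ∈ Set.Ioo (0:ℝ) 1)
    (hμ : μ ∈ Set.Ioo (0:ℝ) 1) {p q : Y × Y} (hp : p ∈ scaleComp ρ x ε μ)
    (hq : q ∈ scaleComp ρ x ε μ) :
    |dist p.2 q.2 - (1/μ) * dist p.1 q.1| ≤ F (ε * μ) + (1/μ) * F ε := by
  obtain ⟨a, -, ha₁, ha₂⟩ := hp
  obtain ⟨b, -, hb₁, hb₂⟩ := hq
  have hεμ : ε * μ ∈ Set.Ioo (0:ℝ) 1 :=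
    ⟨mul_pos hε.1 hμ.1, mul_lt_one_of_nonneg_of_lt_one_left hε.1.le hε.2 hμ.2.le⟩
  have hμ₀ : 0 ≤ 1 / μ := one_div_nonneg.2 hμ.1.le
  have hfine := hz.acc_le _ hεμ _ ha₂ _ hb₂
  have hcoarse := mul_le_mul_of_nonneg_left (hz.acc_le _ hε _ ha₁ _ hb₁) hμ₀
  calc |dist p.2 q.2 - (1/μ) * dist p.1 q.1|
      = |(dist p.2 q.2 - (1/(ε * μ)) * dist a b)
          - (1/μ) * (dist p.1 q.1 - (1/ε) * dist a b)| := by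
        congr 1
        rw [← one_div_mul_one_div]
        ring
    _ ≤ |dist p.2 q.2 - (1/(ε * μ)) * dist a b|
          + |(1/μ) * (dist p.1 q.1 - (1/ε) * dist a b)| := abs_sub _ _
    _ ≤ F (ε * μ) + (1/μ) * F ε := by
        rw [abs_mul, abs_of_nonneg hμ₀]
        exact add_le_add hfine hcoarse

/-- The defect `D(u'',v'') - (1/μ) * D(u',v')` is 1-Lipschitz in each pair with respect
to `D_μ`. -/
theorem abs_dist_sub_le_add_Dmu {μ : ℝ} (hμ : 0 ≤ μ) (a b p q : Y × Y) :
    |dist p.2 q.2 - (1/μ) * dist p.1 q.1|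
      ≤ |dist a.2 b.2 - (1/μ) * dist a.1 b.1| + (Dmu μ a p + Dmu μ b q) := by
  have hμ₀ : 0 ≤ 1 / μ := one_div_nonneg.2 hμ
  have hsnd := abs_le.1 (dist_dist_dist_le a.2 b.2 p.2 q.2)
  have hfst := abs_le.1 (dist_dist_dist_le a.1 b.1 p.1 q.1)
  have hfst_lower := mul_le_mul_of_nonneg_left hfst.1 hμ₀
  have hfst_upper := mul_le_mul_of_nonneg_left hfst.2 hμ₀
  have hab := abs_le.1 (le_refl |dist a.2 b.2 - (1/μ) * dist a.1 b.1|)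
  simp only [Dmu]
  exact abs_le.2 ⟨by linarith, by linarith⟩

/-- for a zoom sequence `ρ^x_ε` with zoom modulus `F`, scale stable at scale
`μ ∈ (0,1)` with modulus `Fμ` and limit relation `ρbar`, the space `(Y,D)` is self-similar
along `ρbar`: for any `(u',u''), (v',v'') ∈ ρbar` we have `D(u'',v'') = (1/μ)·D(u',v')`. -/
theorem scale_stable_self_similar {x : X} {y : Y} {ρ : ℝ → Set (X × Y)} {F Fμ : ℝ → ℝ}
    {μ : ℝ} (hμ : μ ∈ Set.Ioo (0:ℝ) 1) {ρbar : Set (Y × Y)}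
    (hz : IsZoomSeq x y ρ F) (hs : IsScaleStable ρ x y μ ρbar Fμ)
    {u' u'' v' v'' : Y} (hu : (u', u'') ∈ ρbar) (hv : (v', v'') ∈ ρbar) :
    dist u'' v'' = (1/μ) * dist u' v' := by
  have hμ₀ : 0 < μ := hμ.1
  have hscale : Filter.Tendsto (fun ε : ℝ => ε * μ) (nhdsWithin 0 (Set.Ioo 0 1))
      (nhdsWithin 0 (Set.Ioo 0 1)) := by
    refine tendsto_nhdsWithin_iff.2 ⟨?_, ?_⟩
    · exact ((continuous_mul_const μ).tendsto' _ _ (zero_mul μ)).mono_left nhdsWithin_le_nhds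
    · filter_upwards [self_mem_nhdsWithin] with ε hε
      exact ⟨mul_pos hε.1 hμ₀, mul_lt_one_of_nonneg_of_lt_one_left hε.1.le hε.2 hμ.2.le⟩
  have hlim : Filter.Tendsto (fun ε => F (ε * μ) + (1/μ) * F ε + (Fμ ε + Fμ ε))
      (nhdsWithin 0 (Set.Ioo 0 1)) (nhds 0) := by
    simpa using ((hz.F_lim.comp hscale).add (hz.F_lim.const_mul (1/μ))).add
      (hs.Fμ_lim.add hs.Fμ_lim)
  have : (nhdsWithin (0:ℝ) (Set.Ioo 0 1)).NeBot := left_nhdsWithin_Ioo_neBot zero_lt_one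
  have hdefect : |dist u'' v'' - (1/μ) * dist u' v'| ≤ 0 := by
    refine ge_of_tendsto hlim ?_
    filter_upwards [self_mem_nhdsWithin] with ε hε
    obtain ⟨a, ha, hau⟩ := (hs.haus_le ε hε).2 _ hu
    obtain ⟨b, hb, hbv⟩ := (hs.haus_le ε hε).2 _ hv
    exact (abs_dist_sub_le_add_Dmu hμ₀.le a b (u', u'') (v', v'')).trans <|
      add_le_add (hz.abs_dist_sub_le_of_mem_scaleComp hε hμ ha hb) (add_le_add hau hbv)
  exact sub_eq_zero.1 (abs_nonpos_iff.1 hdefect)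
end

section
/- Let ρ^x_ε be a zoom sequence at x ∈ X with zoom modulus F which is scale stable at scale μ ∈ (0,1) with scale stability modulus F_μ and limit relation ρ̄^x_μ. Then ρ̄^x_μ is the graph of an injective function; in particular its precision and resolution are both equal to 0: if (u′,u″) ∈ ρ̄^x_μ and (u′,v″) ∈ ρ̄^x_μ then u″ = v″, and if (u′,u″) ∈ ρ̄^x_μ and (v′,u″) ∈ ρ̄^x_μ then u′ = v′. -/
open Metric ENNReal

variable {X Y : Type*} [MetricSpace X] [MetricSpace Y]

/-- The limit relation scales distances by exactly the factor `1/μ`. -/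
theorem IsScaleStable.dist_snd_eq {x : X} {y : Y} {ρ : ℝ → Set (X × Y)} {F Fμ : ℝ → ℝ}
    {μ : ℝ} (hμ : μ ∈ Set.Ioo (0:ℝ) 1) {ρbar : Set (Y × Y)}
    (hz : IsZoomSeq x y ρ F) (hs : IsScaleStable ρ x y μ ρbar Fμ)
    {p q : Y × Y} (hp : p ∈ ρbar) (hq : q ∈ ρbar) :
    dist p.2 q.2 = (1/μ) * dist p.1 q.1 := by
  have hm : 0 < 1/μ := one_div_pos.mpr hμ.1
  have hεμ : ∀ ε ∈ Set.Ioo (0:ℝ) 1, ε * μ ∈ Set.Ioo (0:ℝ) 1 := fun ε hε =>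
    ⟨mul_pos hε.1 hμ.1, mul_lt_one_of_nonneg_of_lt_one_left hε.1.le hε.2 hμ.2.le⟩
  have bound : ∀ ε ∈ Set.Ioo (0:ℝ) 1, |dist p.2 q.2 - (1/μ) * dist p.1 q.1|
      ≤ F (ε * μ) + (1/μ) * F ε + 2 * Fμ ε := by
    intro ε hε
    obtain ⟨a, ⟨u, -, hu₁, hu₂⟩, ha⟩ := (hs.haus_le ε hε).2 p hp
    obtain ⟨b, ⟨v, -, hv₁, hv₂⟩, hb⟩ := (hs.haus_le ε hε).2 q hq
    have h₁ := abs_le.mp (hz.acc_le ε hε _ hu₁ _ hv₁)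
    have h₂ := abs_le.mp (hz.acc_le (ε * μ) (hεμ ε hε) _ hu₂ _ hv₂)
    have e₁ : |dist a.1 b.1 - dist p.1 q.1| ≤ dist a.1 p.1 + dist b.1 q.1 :=
      dist_dist_dist_le _ _ _ _
    have e₂ : |dist a.2 b.2 - dist p.2 q.2| ≤ dist a.2 p.2 + dist b.2 q.2 :=
      dist_dist_dist_le _ _ _ _
    rw [abs_le] at e₁ e₂
    simp only [Dmu] at ha hb h₁ h₂
    have hscale : 1 / (ε * μ) * dist u v = 1/μ * (1/ε * dist u v) := by
      rw [one_div_mul_eq_div, mul_comm ε μ, ← div_div]; ring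
    rw [hscale] at h₂
    have l₁ := mul_le_mul_of_nonneg_left h₁.1 hm.le
    have r₁ := mul_le_mul_of_nonneg_left h₁.2 hm.le
    have l₂ := mul_le_mul_of_nonneg_left e₁.1 hm.le
    have r₂ := mul_le_mul_of_nonneg_left e₁.2 hm.le
    rw [abs_le]
    constructor <;> linarith [h₂.1, h₂.2, e₂.1, e₂.2]
  have hscaled : Filter.Tendsto (fun ε => ε * μ) (nhdsWithin 0 (Set.Ioo 0 1))
      (nhdsWithin 0 (Set.Ioo 0 1)) := by
    refine tendsto_nhdsWithin_iff.mpr ⟨?_, ?_⟩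
    · have h : Filter.Tendsto (fun ε : ℝ => ε * μ) (nhds 0) (nhds (0 * μ)) :=
        (continuous_mul_const μ).tendsto 0
      rw [zero_mul] at h
      exact h.mono_left nhdsWithin_le_nhds
    · filter_upwards [self_mem_nhdsWithin] with ε hε using hεμ ε hε
  have hlim := ((hz.F_lim.comp hscaled).add (hz.F_lim.const_mul (1/μ))).add
    (hs.Fμ_lim.const_mul 2)
  have : (nhdsWithin (0:ℝ) (Set.Ioo 0 1)).NeBot := by
    rw [nhdsWithin_Ioo_eq_nhdsGT zero_lt_one]; infer_instance
  have hle := ge_of_tendsto hlim (by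
    filter_upwards [self_mem_nhdsWithin] with ε hε using bound ε hε)
  simp only [mul_zero, add_zero] at hle
  exact sub_eq_zero.mp (abs_nonpos_iff.mp hle)

/-- for a zoom sequence `ρ^x_ε` with zoom modulus `F`, scale stable at scale
`μ ∈ (0,1)` with modulus `Fμ` and limit relation `ρbar`, the relation `ρbar` is the graph
of an injective function: it is functional (if `(u',u''), (u',v'') ∈ ρbar` then `u'' = v''`,
i.e. precision `0`) and injective (if `(u',u''), (v',u'') ∈ ρbar` then `u' = v'`, i.e.
resolution `0`). -/
theorem scale_stable_graph_injective {x : X} {y : Y} {ρ : ℝ → Set (X × Y)} {F Fμ : ℝ → ℝ}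
    {μ : ℝ} (hμ : μ ∈ Set.Ioo (0:ℝ) 1) {ρbar : Set (Y × Y)}
    (hz : IsZoomSeq x y ρ F) (hs : IsScaleStable ρ x y μ ρbar Fμ) :
    (∀ u' u'' v'' : Y, (u', u'') ∈ ρbar → (u', v'') ∈ ρbar → u'' = v'') ∧
    (∀ u' v' u'' : Y, (u', u'') ∈ ρbar → (v', u'') ∈ ρbar → u' = v') := by
  refine ⟨fun u' u'' v'' hu hv => ?_, fun u' v' u'' hu hv => ?_⟩
  · simpa using hs.dist_snd_eq hμ hz hu hv
  · have h := hs.dist_snd_eq hμ hz hu hv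
    simpa [hμ.1.ne'] using h
end

section
/- Let ρ^x_ε be a scale stable zoom sequence at x ∈ X with zoom modulus F and scale stability modulus F_μ (at scale μ ∈ (0,1)), whose limit relation ρ̄^x_μ is the graph of a function, and let φ^x_ε be the associated sequence of μ-foveal maps. Then the accuracy of the restricted foveal map φ^x_ε ∩ (B̄(x,εμ) × B̄(y,μ)) at scale ε is bounded by μ·F(εμ): for any u, v ∈ B̄(x,εμ) and u′, v′ ∈ B̄(y,μ) with (u,u′) ∈ φ^x_ε and (v,v′) ∈ φ^x_ε, we have |(1/ε)·d(u,v) − D(u′,v′)| ≤ μ·F(εμ). -/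
open Metric ENNReal

variable {X Y : Type*} [MetricSpace X] [MetricSpace Y]

/-- `ρbar ⊆ B̄(y,μ) × B̄(y,1)` is the graph of the function `g`: every `u' ∈ B̄(y,μ)` is
related exactly to `g u'`. -/
def IsGraphOf (ρbar : Set (Y × Y)) (y : Y) (μ : ℝ) (g : Y → Y) : Prop :=
  (∀ u' ∈ closedBall y μ, (u', g u') ∈ ρbar) ∧ (∀ p ∈ ρbar, p.2 = g p.1)

/-- The `μ`-foveal map `φ^x_ε ⊆ B̄(x,ε) × B̄(y,1)` associated to the zoom sequence `ρ` and
the function `g` whose graph is the limit relation `ρ̄^x_μ`: a pair `(u,u')` belongs to it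
iff either `u ∈ B̄(x,εμ)`, `u' ∈ B̄(y,μ)` and `(u, g u') ∈ ρ (εμ)`, or `u ∉ B̄(x,εμ)` and
`(u,u') ∈ ρ ε`. -/
def foveal (ρ : ℝ → Set (X × Y)) (g : Y → Y) (x : X) (y : Y) (ε μ : ℝ) : Set (X × Y) :=
  {p | (p.1 ∈ closedBall x (ε * μ) ∧ p.2 ∈ closedBall y μ ∧ (p.1, g p.2) ∈ ρ (ε * μ)) ∨
       (p.1 ∉ closedBall x (ε * μ) ∧ p ∈ ρ ε)}

/-- At every scale, the dilation defect of the limit function `g` is controlled by the zoom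
modulus and the scale stability modulus. -/
lemma abs_dilation_defect_le {x : X} {y : Y} {ρ : ℝ → Set (X × Y)} {F Fμ : ℝ → ℝ}
    {μ : ℝ} (hμ : μ ∈ Set.Ioo (0:ℝ) 1) {ρbar : Set (Y × Y)} {g : Y → Y}
    (hz : IsZoomSeq x y ρ F) (hs : IsScaleStable ρ x y μ ρbar Fμ)
    (hg : IsGraphOf ρbar y μ g) {u' v' : Y}
    (hu' : u' ∈ closedBall y μ) (hv' : v' ∈ closedBall y μ)
    {ε : ℝ} (hε : ε ∈ Set.Ioo (0:ℝ) 1) :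
    |(1/μ) * dist u' v' - dist (g u') (g v')| ≤ 2 * Fμ ε + (1/μ) * F ε + F (ε * μ) := by
  obtain ⟨⟨a₁, b₁⟩, ⟨w₁, -, ha₁, hb₁⟩, h₁⟩ := (hs.haus_le ε hε).2 _ (hg.1 u' hu')
  obtain ⟨⟨a₂, b₂⟩, ⟨w₂, -, ha₂, hb₂⟩, h₂⟩ := (hs.haus_le ε hε).2 _ (hg.1 v' hv')
  have hεμ : ε * μ ∈ Set.Ioo (0:ℝ) 1 :=
    ⟨mul_pos hε.1 hμ.1, mul_lt_one_of_nonneg_of_lt_one_left hε.1.le hε.2 hμ.2.le⟩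
  have hμ' : 0 ≤ 1 / μ := one_div_nonneg.mpr hμ.1.le
  have hA := mul_le_mul_of_nonneg_left (hz.acc_le ε hε _ ha₁ _ ha₂) hμ'
  have hB := hz.acc_le (ε * μ) hεμ _ hb₁ _ hb₂
  have hC := mul_le_mul_of_nonneg_left (dist_dist_dist_le a₁ a₂ u' v') hμ'
  have hD := dist_dist_dist_le b₁ b₂ (g u') (g v')
  have hscale : 1 / (ε * μ) * dist w₁ w₂ = 1 / μ * (1 / ε * dist w₁ w₂) := by
    rw [one_div_mul_eq_div, one_div_mul_eq_div, one_div_mul_eq_div, div_div]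
  simp only [Dmu] at h₁ h₂
  simp only [hscale] at hB
  rw [← abs_of_nonneg hμ', ← abs_mul, abs_of_nonneg hμ'] at hA
  rw [Real.dist_eq, ← abs_of_nonneg hμ', ← abs_mul, abs_of_nonneg hμ'] at hC
  rw [Real.dist_eq] at hD
  rw [abs_le] at *
  constructor <;> linarith [hA.1, hA.2, hB.1, hB.2, hC.1, hC.2, hD.1, hD.2]

/-- The limit function of a scale stable zoom sequence is an exact dilation by `1/μ`. -/
lemma dist_map_eq_of_isScaleStable {x : X} {y : Y} {ρ : ℝ → Set (X × Y)} {F Fμ : ℝ → ℝ}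
    {μ : ℝ} (hμ : μ ∈ Set.Ioo (0:ℝ) 1) {ρbar : Set (Y × Y)} {g : Y → Y}
    (hz : IsZoomSeq x y ρ F) (hs : IsScaleStable ρ x y μ ρbar Fμ)
    (hg : IsGraphOf ρbar y μ g) {u' v' : Y}
    (hu' : u' ∈ closedBall y μ) (hv' : v' ∈ closedBall y μ) :
    dist (g u') (g v') = (1/μ) * dist u' v' := by
  have hmul : Filter.Tendsto (fun ε : ℝ => ε * μ) (nhdsWithin 0 (Set.Ioo 0 1))
      (nhdsWithin 0 (Set.Ioo 0 1)) := by
    refine tendsto_nhdsWithin_iff.mpr ⟨?_, ?_⟩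
    · exact ((continuous_mul_const μ).tendsto' 0 0 (zero_mul μ)).mono_left nhdsWithin_le_nhds
    · filter_upwards [self_mem_nhdsWithin] with ε hε
      exact ⟨mul_pos hε.1 hμ.1, mul_lt_one_of_nonneg_of_lt_one_left hε.1.le hε.2 hμ.2.le⟩
  have hlim : Filter.Tendsto (fun ε => 2 * Fμ ε + (1/μ) * F ε + F (ε * μ))
      (nhdsWithin 0 (Set.Ioo 0 1)) (nhds 0) := by
    simpa using ((hs.Fμ_lim.const_mul 2).add (hz.F_lim.const_mul (1/μ))).add
      (hz.F_lim.comp hmul)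
  have : (nhdsWithin (0:ℝ) (Set.Ioo 0 1)).NeBot := left_nhdsWithin_Ioo_neBot zero_lt_one
  have hle : |(1/μ) * dist u' v' - dist (g u') (g v')| ≤ 0 :=
    ge_of_tendsto hlim (by
      filter_upwards [self_mem_nhdsWithin] with ε hε
      exact abs_dilation_defect_le hμ hz hs hg hu' hv' hε)
  exact (sub_eq_zero.mp (abs_nonpos_iff.mp hle)).symm

/-- for a scale stable zoom sequence `ρ^x_ε` (zoom modulus `F`, scale
stability modulus `Fμ` at scale `μ ∈ (0,1)`) whose limit relation `ρ̄^x_μ` is the graph of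
a function `g`, the accuracy of the restricted `μ`-foveal map
`φ^x_ε ∩ (B̄(x,εμ) × B̄(y,μ))` at scale `ε` is bounded by `μ·F(εμ)`: for any
`u, v ∈ B̄(x,εμ)` and `u', v' ∈ B̄(y,μ)` with `(u,u'), (v,v') ∈ φ^x_ε`, we have
`|(1/ε)·d(u,v) − D(u',v')| ≤ μ·F(εμ)`. -/
theorem foveal_restricted_acc {x : X} {y : Y} {ρ : ℝ → Set (X × Y)} {F Fμ : ℝ → ℝ}
    {μ : ℝ} (hμ : μ ∈ Set.Ioo (0:ℝ) 1) {ρbar : Set (Y × Y)} {g : Y → Y}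
    (hz : IsZoomSeq x y ρ F) (hs : IsScaleStable ρ x y μ ρbar Fμ)
    (hg : IsGraphOf ρbar y μ g)
    {ε : ℝ} (hε : ε ∈ Set.Ioo (0:ℝ) 1)
    {u v : X} {u' v' : Y}
    (hu : u ∈ closedBall x (ε * μ)) (hv : v ∈ closedBall x (ε * μ))
    (hu' : u' ∈ closedBall y μ) (hv' : v' ∈ closedBall y μ)
    (huu : (u, u') ∈ foveal ρ g x y ε μ) (hvv : (v, v') ∈ foveal ρ g x y ε μ) :
    |(1/ε) * dist u v - dist u' v'| ≤ μ * F (ε * μ) := by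
  have hεμ : ε * μ ∈ Set.Ioo (0:ℝ) 1 :=
    ⟨mul_pos hε.1 hμ.1, mul_lt_one_of_nonneg_of_lt_one_left hε.1.le hε.2 hμ.2.le⟩
  have hgu : (u, g u') ∈ ρ (ε * μ) := huu.elim (fun h => h.2.2) fun h => absurd hu h.1
  have hgv : (v, g v') ∈ ρ (ε * μ) := hvv.elim (fun h => h.2.2) fun h => absurd hv h.1
  have hacc := hz.acc_le (ε * μ) hεμ _ hgu _ hgv
  simp only [dist_map_eq_of_isScaleStable hμ hz hs hg hu' hv'] at hacc
  have hμ₀ := hμ.1.ne'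
  have hε₀ := hε.1.ne'
  calc |(1/ε) * dist u v - dist u' v'|
      = |μ * ((1/μ) * dist u' v' - 1 / (ε * μ) * dist u v)| := by
        rw [abs_sub_comm]
        congr 1
        field_simp
    _ = μ * |(1/μ) * dist u' v' - 1 / (ε * μ) * dist u v| := by
        rw [abs_mul, abs_of_pos hμ.1]
    _ ≤ μ * F (ε * μ) := mul_le_mul_of_nonneg_left hacc hμ.1.le
end

section
/- (Viewpoint stability, analogue of the scale stability proposition.) Let ρ^x_ε be a zoom sequence at x ∈ X with zoom modulus F, fix u′ ∈ B̄(y,1), and for each ε ∈ (0,1) choose x₁(ε) ∈ B̄(x,ε) with (x₁(ε),u′) ∈ ρ^x_ε; suppose that at each x₁(ε) there is also a zoom sequence ρ^{x₁(ε)}_ε with the same zoom modulus F. Define the difference relation at scale ε, Δ^x_ε(u′,·) ⊆ B̄(y,1) × B̄(y,1), by: (v′,v″) ∈ Δ^x_ε(u′,·) iff there exists v ∈ B̄(x,ε) ∩ B̄(x₁(ε),ε) with (v,v′) ∈ ρ^x_ε and (v,v″) ∈ ρ^{x₁(ε)}_ε. Assume the zoom sequence is viewpoint stable: there is a relation Δ^x(u′,·)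 ⊆ B̄(y,1) × B̄(y,1) and a function F_diff : (0,1) → [0,+∞) with lim_{ε→0} F_diff(ε) = 0 such that the Hausdorff distance (with respect to the sum distance D(v′,w′) + D(v″,w″) on B̄(y,1) × B̄(y,1)) between Δ^x_ε(u′,·) and Δ^x(u′,·) is at most F_diff(ε) for all ε ∈ (0,1). Then Δ^x(u′,·) is the graph of an isometry: for any (v′,v″), (w′,w″) ∈ Δ^x(u′,·) we have D(v″,w″) = D(v′,w′); in particular, if (v′,v″), (v′,w″) ∈ Δ^x(u′,·) then v″ = w″. -/
open Metric ENNReal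

variable {X Y : Type*} [MetricSpace X] [MetricSpace Y]

/-- The difference relation at scale `ε`, from `x` to `x₁`, as seen from a pixel:
`(v',v'') ∈ Δ^x_ε` iff there is `v ∈ B̄(x,ε) ∩ B̄(x₁,ε)` with `(v,v') ∈ ρ` and
`(v,v'') ∈ σ`, where `ρ = ρ^x_ε` and `σ = ρ^{x₁}_ε`. -/
def diffRel (ρ σ : Set (X × Y)) (x x₁ : X) (ε : ℝ) : Set (Y × Y) :=
  {p | ∃ v : X, v ∈ closedBall x ε ∧ v ∈ closedBall x₁ ε ∧ (v, p.1) ∈ ρ ∧ (v, p.2) ∈ σ}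

/-- The sum distance `D((v',v''),(w',w'')) = D(v',w') + D(v'',w'')` on `Y × Y`. -/
noncomputable def DSum (p q : Y × Y) : ℝ := dist p.1 q.1 + dist p.2 q.2

/-- The Hausdorff distance between `A, B ⊆ Y × Y`, computed with respect to the sum
distance `DSum`, is at most `c`. -/
def hausLeSum (A B : Set (Y × Y)) (c : ℝ) : Prop :=
  (∀ a ∈ A, ∃ b ∈ B, DSum a b ≤ c) ∧ (∀ b ∈ B, ∃ a ∈ A, DSum a b ≤ c)

/-- Two relations of accuracy `c` at the same scale have a difference relation that distorts
distances by at most `2 * c`. -/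
lemma abs_dist_sub_dist_le_of_mem_diffRel {ρ σ : Set (X × Y)} {x x₁ : X} {ε c : ℝ}
    (hρ : ∀ p ∈ ρ, ∀ q ∈ ρ, |dist p.2 q.2 - (1/ε) * dist p.1 q.1| ≤ c)
    (hσ : ∀ p ∈ σ, ∀ q ∈ σ, |dist p.2 q.2 - (1/ε) * dist p.1 q.1| ≤ c)
    {a b : Y × Y} (ha : a ∈ diffRel ρ σ x x₁ ε) (hb : b ∈ diffRel ρ σ x x₁ ε) :
    |dist a.2 b.2 - dist a.1 b.1| ≤ 2 * c := by
  obtain ⟨v, -, -, hvρ, hvσ⟩ := ha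
  obtain ⟨w, -, -, hwρ, hwσ⟩ := hb
  have h₁ := abs_le.mp (hρ _ hvρ _ hwρ)
  have h₂ := abs_le.mp (hσ _ hvσ _ hwσ)
  dsimp only at h₁ h₂
  rw [abs_le]
  constructor <;> linarith

/-- Approximating a relation in Hausdorff distance changes its distortion by at most twice
the Hausdorff distance. -/
lemma abs_dist_sub_dist_le_of_hausLeSum {A B : Set (Y × Y)} {c r : ℝ} (h : hausLeSum A B r)
    (hA : ∀ a ∈ A, ∀ b ∈ A, |dist a.2 b.2 - dist a.1 b.1| ≤ c)
    {p q : Y × Y} (hp : p ∈ B) (hq : q ∈ B) :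
    |dist p.2 q.2 - dist p.1 q.1| ≤ c + 2 * r := by
  obtain ⟨a, ha, hap⟩ := h.2 p hp
  obtain ⟨b, hb, hbq⟩ := h.2 q hq
  have hab := abs_le.mp (hA a ha b hb)
  have h₁ := abs_le.mp (dist_dist_dist_le a.1 b.1 p.1 q.1)
  have h₂ := abs_le.mp (dist_dist_dist_le a.2 b.2 p.2 q.2)
  unfold DSum at hap hbq
  rw [abs_le]
  constructor <;> linarith

/-- viewpoint stability: let `ρ^x_ε` be a zoom sequence at `x` with zoom
modulus `F`, `u' ∈ B̄(y,1) = Y` a fixed pixel, and for each `ε ∈ (0,1)` let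
`x₁ ε ∈ B̄(x,ε)` with `(x₁ ε, u') ∈ ρ^x_ε`; suppose at each `x₁ ε` there is a zoom
sequence `ρ₁ ε` (with some base pixel `y₁ ε`) with the same zoom modulus `F`. If the zoom
sequence is viewpoint stable — there are `Δ ⊆ B̄(y,1) × B̄(y,1)` and
`F_diff : (0,1) → [0,∞)` with `F_diff(ε) → 0` such that for all `ε ∈ (0,1)` the Hausdorff
distance (w.r.t. the sum distance) between the difference relation `Δ^x_ε(u',·)` and `Δ`
is at most `F_diff ε` — then `Δ` is the graph of an isometry: for any
`(v',v''), (w',w'') ∈ Δ` we have `D(v'',w'') = D(v',w')`; in particular if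
`(v',v''), (v',w'') ∈ Δ` then `v'' = w''`. -/
theorem viewpoint_stable_isometry {x : X} {y : Y} {ρ : ℝ → Set (X × Y)} {F : ℝ → ℝ}
    (hz : IsZoomSeq x y ρ F) (u' : Y)
    (x₁ : ℝ → X) (hx₁ : ∀ ε ∈ Set.Ioo (0:ℝ) 1, x₁ ε ∈ closedBall x ε ∧ (x₁ ε, u') ∈ ρ ε)
    (ρ₁ : ℝ → ℝ → Set (X × Y)) (y₁ : ℝ → Y)
    (hz₁ : ∀ ε ∈ Set.Ioo (0:ℝ) 1, IsZoomSeq (x₁ ε) (y₁ ε) (ρ₁ ε) F)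
    (Δ : Set (Y × Y)) (Fdiff : ℝ → ℝ)
    (hFdiff_nonneg : ∀ ε ∈ Set.Ioo (0:ℝ) 1, 0 ≤ Fdiff ε)
    (hFdiff_lim : Filter.Tendsto Fdiff (nhdsWithin 0 (Set.Ioo 0 1)) (nhds 0))
    (hH : ∀ ε ∈ Set.Ioo (0:ℝ) 1,
      hausLeSum (diffRel (ρ ε) (ρ₁ ε ε) x (x₁ ε) ε) Δ (Fdiff ε)) :
    (∀ v' v'' w' w'' : Y, (v', v'') ∈ Δ → (w', w'') ∈ Δ → dist v'' w'' = dist v' w') ∧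
    (∀ v' v'' w'' : Y, (v', v'') ∈ Δ → (v', w'') ∈ Δ → v'' = w'') := by
  have : (nhdsWithin (0:ℝ) (Set.Ioo 0 1)).NeBot := by
    rw [nhdsWithin_Ioo_eq_nhdsGT one_pos]
    infer_instance
  have isom : ∀ p ∈ Δ, ∀ q ∈ Δ, dist p.2 q.2 = dist p.1 q.1 := by
    intro p hp q hq
    have hlim : Filter.Tendsto (fun ε => 2 * F ε + 2 * Fdiff ε)
        (nhdsWithin 0 (Set.Ioo 0 1)) (nhds 0) := by
      simpa using (hz.F_lim.const_mul 2).add (hFdiff_lim.const_mul 2)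
    have hle : |dist p.2 q.2 - dist p.1 q.1| ≤ 0 := by
      refine ge_of_tendsto hlim ?_
      filter_upwards [self_mem_nhdsWithin] with ε hε
      exact abs_dist_sub_dist_le_of_hausLeSum (hH ε hε)
        (fun a ha b hb => abs_dist_sub_dist_le_of_mem_diffRel (hz.acc_le ε hε)
          ((hz₁ ε hε).acc_le ε hε) ha hb) hp hq
    exact sub_eq_zero.mp (abs_nonpos_iff.mp hle)
  refine ⟨fun v' v'' w' w'' hv hw => isom _ hv _ hw, fun v' v'' w'' hv hw => ?_⟩
  exact dist_eq_zero.mp ((isom _ hv _ hw).trans (dist_self v'))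
end
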